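/- Assume (E): Λ : ℤ^d → A is a colouring and (Q_j)_{j∈ℕ} a van Hove sequence such that for every box pattern P at the origin the frequency ν_P of P in Λ along (Q_j) exists. Let X be a Banach space and F : 𝓕 → X be Λ-invariant (with induced map F̃ on box patterns at the origin), almost-additive with boundary term b (with constant D such that b(Q) ≤ D|Q|), and bounded with constant C. Then for all j, M ∈ ℕ the quantity Δ(j,M) := ‖F(Q_j)/|Q_j| − Σ_{P∈𝓟_M} ν_P F̃(P)/|C_M|‖ satisfies Δ(j,M) ≤ b(C_M)/|C_M| + (C+D)·|∂^M Q_j|/|Q_j| + C·Σ_{P∈𝓟_M} |♯_P(Λ∩Q_j)/|Q_j| − ν_P|. -/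

import Mathlib

open Filter
noncomputable section

/-- `ℤ^d`. -/
abbrev Zd (d : ℕ) := Fin d → ℤ

namespace IDSZd

variable {d : ℕ} {A : Type*} {X : Type*}

/-- The ℓ∞ (maximum) distance on `ℤ^d`, as a natural number. -/
def dInf (x y : Zd d) : ℕ := Finset.univ.sup fun j => (x j - y j).natAbs

/-- The closed ℓ∞-ball of radius `S` around `q`, as a finset. -/
def ball (q : Zd d) (S : ℕ) : Finset (Zd d) :=
  Fintype.piFinset fun j => Finset.Icc (q j - S) (q j + S)

open Classical in
/-- The `S`-boundary `∂^S Q` of a finite set `Q ⊆ ℤ^d`:  points outside `Q` within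
distance `S` of `Q` together with points of `Q` within distance `S` of the complement. -/
def sBdry (S : ℕ) (Q : Finset (Zd d)) : Finset (Zd d) :=
  ((Q.biUnion fun q => ball q S).filter fun x => x ∉ Q) ∪
    (Q.filter fun x => ∃ y : Zd d, y ∉ Q ∧ dInf x y ≤ S)

/-- A van Hove sequence of (nonempty) finite subsets of `ℤ^d`. -/
def VanHove (Q : ℕ → Finset (Zd d)) : Prop :=
  (∀ j, (Q j).Nonempty) ∧
    ∀ S : ℕ, Tendsto (fun j => ((sBdry S (Q j)).card : ℝ) / ((Q j).card : ℝ)) atTop (nhds 0)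

/-- The translate `t + Q` of a finite set `Q ⊆ ℤ^d`. -/
def shift (t : Zd d) (Q : Finset (Zd d)) : Finset (Zd d) := Q.image (t + ·)

/-- The box `C_M = {0, …, M−1}^d`. -/
def cube (d M : ℕ) : Finset (Zd d) := Fintype.piFinset fun _ => Finset.Ico (0 : ℤ) (M : ℤ)

/-- A box `[a₁,b₁] × ⋯ × [a_d,b_d]` in `ℤ^d`. -/
def IsBox (Q : Finset (Zd d)) : Prop :=
  ∃ a b : Zd d, (∀ j, a j ≤ b j) ∧ Q = Fintype.piFinset fun j => Finset.Icc (a j) (b j)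

/-- A box at the origin, i.e. `[0,b₁] × ⋯ × [0,b_d]`. -/
def IsBoxAtOrigin (Q : Finset (Zd d)) : Prop :=
  ∃ b : Zd d, (∀ j, 0 ≤ b j) ∧ Q = Fintype.piFinset fun j => Finset.Icc 0 (b j)

open Classical in
/-- The number of occurrences `♯_P P'` of the pattern `P` with domain `B` (given by a
total function) in the pattern `P'` with domain `Q` given by the total function `L`. -/
def occ (B : Finset (Zd d)) (P : Zd d → A) (Q : Finset (Zd d)) (L : Zd d → A) : ℕ :=
  (Q.filter fun x => shift x B ⊆ Q ∧ ∀ y ∈ B, L (x + y) = P y).card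

/-- Extension of a pattern `P` with domain `B` to a total function on `ℤ^d`
(by a junk value taken from the colouring `Λ`). -/
def extPat (Λ : Zd d → A) (B : Finset (Zd d)) (P : ↥B → A) : Zd d → A :=
  fun y => if h : y ∈ B then P ⟨y, h⟩ else Λ 0

/-- `ν` is the frequency function of the colouring `Λ` along the sequence `Q`:
for every box pattern at the origin the frequency exists and is given by `ν`. -/
def Freqs (Λ : Zd d → A) (Q : ℕ → Finset (Zd d)) (ν : Finset (Zd d) → (Zd d → A) → ℝ) : Prop :=
  ∀ B : Finset (Zd d), IsBoxAtOrigin B → ∀ P : Zd d → A,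
    Tendsto (fun j => (occ B P (Q j) Λ : ℝ) / ((Q j).card : ℝ)) atTop (nhds (ν B P))

/-- A boundary term with constant `D`. -/
def IsBoundaryTerm (b : Finset (Zd d) → ℝ) (D : ℝ) : Prop :=
  (∀ Q, 0 ≤ b Q) ∧ (∀ t Q, b (shift t Q) = b Q) ∧
    (∀ Q : ℕ → Finset (Zd d), VanHove Q →
      Tendsto (fun j => b (Q j) / ((Q j).card : ℝ)) atTop (nhds 0)) ∧
    0 < D ∧ ∀ Q : Finset (Zd d), b Q ≤ D * Q.card

section NormedX
variable [NormedAddCommGroup X]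

/-- Almost additivity of `F` with boundary term `b`. -/
def AlmostAdditive (F : Finset (Zd d) → X) (b : Finset (Zd d) → ℝ) : Prop :=
  ∀ (m : ℕ) (Qs : Fin m → Finset (Zd d)), (∀ k l, k ≠ l → Disjoint (Qs k) (Qs l)) →
    ‖F (Finset.univ.biUnion Qs) - ∑ k, F (Qs k)‖ ≤ ∑ k, b (Qs k)

/-- `Λ`-invariance of `F`. -/
def Invariant (Λ : Zd d → A) (F : Finset (Zd d) → X) : Prop :=
  ∀ (t : Zd d) (Q : Finset (Zd d)), (∀ y ∈ Q, Λ (t + y) = Λ y) → F (shift t Q) = F Q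

/-- `Ft` is the map on box patterns at the origin (given by domain and total function,
depending only on the restriction of the function to the domain) induced by the
`Λ`-invariant map `F`. -/
def IsInducedMap (Λ : Zd d → A) (F : Finset (Zd d) → X)
    (Ft : Finset (Zd d) → (Zd d → A) → X) : Prop :=
  (∀ (B : Finset (Zd d)) (P P' : Zd d → A), (∀ y ∈ B, P y = P' y) → Ft B P = Ft B P') ∧
    ∀ (t : Zd d) (Q : Finset (Zd d)), IsBoxAtOrigin Q →
      F (shift t Q) = Ft Q fun y => Λ (t + y)

/-- Boundedness of `F` with constant `C`. -/
def Bounded (F : Finset (Zd d) → X) (C : ℝ) : Prop := ∀ Q : Finset (Zd d), ‖F Q‖ ≤ C * Q.card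

/-- The pattern average `Σ_{P ∈ 𝓟_M} ν_P F̃(P) / |C_M|`. -/
def patAvg [NormedSpace ℝ X] [Fintype A] (Λ : Zd d → A)
    (ν : Finset (Zd d) → (Zd d → A) → ℝ) (Ft : Finset (Zd d) → (Zd d → A) → X) (M : ℕ) : X :=
  (((cube d M).card : ℝ))⁻¹ • ∑ P : ↥(cube d M) → A,
    ν (cube d M) (extPat Λ (cube d M) P) • Ft (cube d M) (extPat Λ (cube d M) P)

end NormedX

/-- The set of shifts `a` with `C_M(a) ∩ Q ≠ ∅`. -/
def coverShifts (Q : Finset (Zd d)) (M : ℕ) : Finset (Zd d) :=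
  Q.biUnion fun q => Fintype.piFinset fun j => Finset.Ioc (q j - M) (q j)

/-- The set `D_{Q,x,M}` of lattice shifts `a ∈ x + (Mℤ)^d` whose box `C_M(a)` meets `Q`
but is not contained in `Q`. -/
def latticeD (Q : Finset (Zd d)) (x : Zd d) (M : ℕ) : Finset (Zd d) :=
  (coverShifts Q M).filter fun a => (∀ j, (M : ℤ) ∣ (a j - x j)) ∧ ¬ shift a (cube d M) ⊆ Q

/-- The set `I_{Q,x,M}` of lattice shifts `a ∈ x + (Mℤ)^d` with `C_M(a) ⊆ Q` (for `M ≥ 1`). -/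
def latticeI (Q : Finset (Zd d)) (x : Zd d) (M : ℕ) : Finset (Zd d) :=
  (coverShifts Q M).filter fun a => (∀ j, (M : ℤ) ∣ (a j - x j)) ∧ shift a (cube d M) ⊆ Q


lemma aa_finset [NormedAddCommGroup X] {F : Finset (Zd d) → X} {b : Finset (Zd d) → ℝ}
    (hAA : AlmostAdditive F b) {ι : Type*} (T : Finset ι) (f : ι → Finset (Zd d))
    (hf : ∀ a ∈ T, ∀ a' ∈ T, a ≠ a' → Disjoint (f a) (f a')) :
    ‖F (T.biUnion f) - ∑ a ∈ T, F (f a)‖ ≤ ∑ a ∈ T, b (f a) := by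
  have h := hAA T.card (fun k => f (T.equivFin.symm k)) (by
    intro k l hkl
    apply hf _ (T.equivFin.symm k).2 _ (T.equivFin.symm l).2
    intro h
    exact hkl (T.equivFin.symm.injective (Subtype.ext h)))
  have e1 : (Finset.univ.biUnion fun k => f (T.equivFin.symm k)) = T.biUnion f := by
    ext z
    simp only [Finset.mem_biUnion, Finset.mem_univ, true_and]
    constructor
    · rintro ⟨k, hk⟩
      exact ⟨_, (T.equivFin.symm k).2, hk⟩
    · rintro ⟨a, ha, hz⟩
      exact ⟨T.equivFin ⟨a, ha⟩, by simpa using hz⟩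
  have e2 : ∀ {Y : Type _} [AddCommMonoid Y] (g : ι → Y),
      ∑ k, g (T.equivFin.symm k) = ∑ a ∈ T, g a := by
    intro Y _ g
    rw [Equiv.sum_comp T.equivFin.symm (fun a : T => g a)]
    exact Finset.sum_coe_sort T g
  rw [e1, e2 (fun a => F (f a))] at h
  have e3 : ∑ k, b (f (T.equivFin.symm k)) = ∑ a ∈ T, b (f a) := by
    rw [Equiv.sum_comp T.equivFin.symm (fun a : T => b (f a))]
    exact Finset.sum_coe_sort T (fun a => b (f a))
  rwa [e3] at h

lemma mem_cube {M : ℕ} {y : Zd d} : y ∈ cube d M ↔ ∀ j, 0 ≤ y j ∧ y j < M := by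
  simp [cube]

lemma mem_shift_cube {M : ℕ} {a y : Zd d} :
    y ∈ shift a (cube d M) ↔ ∀ j, a j ≤ y j ∧ y j < a j + M := by
  simp only [shift, Finset.mem_image, mem_cube]
  constructor
  · rintro ⟨z, hz, rfl⟩ j
    have := hz j
    simp only [Pi.add_apply]
    omega
  · intro h
    refine ⟨y - a, fun j => ?_, by simp⟩
    have := h j
    simp only [Pi.sub_apply]
    omega

lemma card_shift (a : Zd d) (B : Finset (Zd d)) : (shift a B).card = B.card :=
  Finset.card_image_of_injective _ (add_right_injective a)

lemma self_mem_shift {M : ℕ} (hM : 1 ≤ M) (a : Zd d) : a ∈ shift a (cube d M) := by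
  rw [mem_shift_cube]
  intro j
  omega

lemma cube_box {M : ℕ} (hM : 1 ≤ M) : IsBoxAtOrigin (cube d M) := by
  refine ⟨fun _ => (M : ℤ) - 1, fun _ => by simp; omega, ?_⟩
  ext y
  rw [mem_cube]
  simp only [Fintype.mem_piFinset, Finset.mem_Icc]
  refine forall_congr' fun j => ?_
  omega

/-- base point of the tile of `x + Mℤ^d` containing `q` -/
def tileBase (M : ℕ) (x q : Zd d) : Zd d := fun j => x j + M * ((q j - x j) / M)

lemma mem_tile {M : ℕ} (hM : 1 ≤ M) (x q : Zd d) :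
    q ∈ shift (tileBase M x q) (cube d M) := by
  rw [mem_shift_cube]
  intro j
  have hM' : (0 : ℤ) < M := by omega
  have h1 := Int.emod_add_mul_ediv (q j - x j) M
  have h2 := Int.emod_nonneg (q j - x j) hM'.ne'
  have h3 := Int.emod_lt_of_pos (q j - x j) hM'
  simp only [tileBase]
  omega

lemma tileBase_eq {M : ℕ} (hM : 1 ≤ M) (x q q' : Zd d)
    (h : q' ∈ shift (tileBase M x q) (cube d M)) : tileBase M x q' = tileBase M x q := by
  rw [mem_shift_cube] at h
  ext j
  have hM' : (0 : ℤ) < M := by omega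
  have h1 := h j
  simp only [tileBase] at h1 ⊢
  have : (q' j - x j) / (M : ℤ) = (q j - x j) / (M : ℤ) := by
    rw [Int.ediv_eq_iff_of_pos hM']
    constructor <;> nlinarith
  rw [this]

/-- residue of `a` modulo `M` -/
def resid (M : ℕ) (a : Zd d) : Zd d := fun j => a j % M

lemma resid_mem {M : ℕ} (hM : 1 ≤ M) (a : Zd d) : resid M a ∈ cube d M := by
  rw [mem_cube]
  intro j
  have hM' : (0 : ℤ) < M := by omega
  exact ⟨Int.emod_nonneg _ hM'.ne', Int.emod_lt_of_pos _ hM'⟩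

lemma tileBase_self_iff {M : ℕ} (x a : Zd d) (hx : x ∈ cube d M) :
    tileBase M x a = a ↔ resid M a = x := by
  rw [mem_cube] at hx
  simp only [funext_iff]
  refine forall_congr' fun j => ?_
  have h := hx j
  simp only [tileBase, resid]
  have hx' : x j % M = x j := Int.emod_eq_of_lt h.1 h.2
  have h1 := Int.emod_add_mul_ediv (a j - x j) M
  constructor
  · intro e
    have : (M : ℤ) ∣ a j - x j := ⟨(a j - x j) / M, by linarith⟩
    have := (Int.emod_emod_of_dvd (a j) (dvd_refl (M : ℤ)))
    rw [← e, Int.add_mul_emod_self_left, hx']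
  · intro e
    have h2 : (a j - x j) % M = 0 := by
      rw [Int.sub_emod, hx', e]; simp
    rw [h2] at h1
    linarith

open Classical in
/-- base points of cubes contained in `Q` -/
def good (M : ℕ) (Q : Finset (Zd d)) : Finset (Zd d) :=
  Q.filter fun a => shift a (cube d M) ⊆ Q

open Classical in
lemma tile_estimate [NormedAddCommGroup X] {F : Finset (Zd d) → X} {b : Finset (Zd d) → ℝ}
    {D C : ℝ} (hb : IsBoundaryTerm b D) (hAA : AlmostAdditive F b) (hC : 0 < C)
    (hBd : Bounded F C) (Q : Finset (Zd d)) {M : ℕ} (hM : 1 ≤ M) (x : Zd d)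
    (hx : x ∈ cube d M) :
    ‖F Q - ∑ a ∈ (good M Q).filter (fun a => resid M a = x), F (shift a (cube d M))‖ ≤
      Q.card * (b (cube d M) / (cube d M).card) + (C + D) * (sBdry M Q).card := by
  obtain ⟨hb0, hbt, -, hD, hbD⟩ := hb
  set T := Q.image (tileBase M x) with hT
  set f : Zd d → Finset (Zd d) := fun a => Q.filter fun q => tileBase M x q = a with hf
  set β := b (cube d M) / (cube d M).card with hβ
  have hcard : (0 : ℝ) < (cube d M).card := by
    have : x ∈ cube d M := hx
    exact_mod_cast Finset.card_pos.2 ⟨x, hx⟩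
  have hβ0 : 0 ≤ β := div_nonneg (hb0 _) hcard.le
  have hU : T.biUnion f = Q := by
    ext q
    simp only [hT, hf, Finset.mem_biUnion, Finset.mem_filter]
    exact ⟨fun ⟨_, _, h, _⟩ => h, fun h => ⟨_, Finset.mem_image_of_mem _ h, h, rfl⟩⟩
  have hmain := aa_finset hAA T f (by
    intro a _ a' _ hne
    rw [Finset.disjoint_left]
    intro q h1 h2
    exact hne ((Finset.mem_filter.1 h1).2.symm.trans (Finset.mem_filter.1 h2).2))
  rw [hU] at hmain
  have hgood : (good M Q).filter (fun a => resid M a = x) =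
      T.filter (fun a => shift a (cube d M) ⊆ Q) := by
    ext a
    simp only [good, Finset.mem_filter]
    constructor
    · rintro ⟨⟨h1, h2⟩, h3⟩
      exact ⟨Finset.mem_image.2 ⟨a, h1, (tileBase_self_iff x a hx).2 h3⟩, h2⟩
    · rintro ⟨h1, h2⟩
      obtain ⟨q, hq, rfl⟩ := Finset.mem_image.1 h1
      have hs := self_mem_shift hM (tileBase M x q)
      exact ⟨⟨h2 hs, h2⟩, (tileBase_self_iff x _ hx).1 (tileBase_eq hM _ _ _ hs)⟩
  have hfib : ∀ a ∈ T, ∀ q ∈ Q, q ∈ shift a (cube d M) ↔ tileBase M x q = a := by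
    intro a ha q hq
    obtain ⟨p, hp, rfl⟩ := Finset.mem_image.1 ha
    exact ⟨fun h => tileBase_eq hM _ _ _ h, fun h => h ▸ mem_tile hM x q⟩
  have hterm : ∀ a ∈ T,
      ‖F (f a) - if shift a (cube d M) ⊆ Q then F (shift a (cube d M)) else 0‖ + b (f a) ≤
        ∑ q ∈ f a, (β + if q ∈ sBdry M Q then (C + D) else 0) := by
    intro a ha
    split_ifs with hs
    · have e : f a = shift a (cube d M) := by
        ext q
        simp only [hf, Finset.mem_filter]
        exact ⟨fun h => (hfib a ha q h.1).2 h.2, fun h => ⟨hs h, (hfib a ha q (hs h)).1 h⟩⟩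
      rw [e, sub_self, norm_zero, zero_add, hbt]
      calc b (cube d M) = ∑ q ∈ shift a (cube d M), β := by
            rw [Finset.sum_const, card_shift, nsmul_eq_mul, hβ]
            field_simp
        _ ≤ _ := Finset.sum_le_sum fun q _ => by
            split_ifs <;> linarith
    · rw [sub_zero]
      calc ‖F (f a)‖ + b (f a) ≤ C * (f a).card + D * (f a).card :=
            add_le_add (hBd _) (hbD _)
        _ = ∑ q ∈ f a, (C + D) := by
            rw [Finset.sum_const, nsmul_eq_mul]; ring
        _ ≤ _ := Finset.sum_le_sum fun q hq => by
            have hq' := Finset.mem_filter.1 hq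
            have : q ∈ sBdry M Q := by
              unfold sBdry
              apply Finset.mem_union_right
              rw [Finset.mem_filter]
              refine ⟨hq'.1, ?_⟩
              obtain ⟨y, hy, hyQ⟩ := Finset.not_subset.1 hs
              refine ⟨y, hyQ, ?_⟩
              have h1 := mem_shift_cube.1 hy
              have h2 := mem_shift_cube.1 ((hfib a ha q hq'.1).2 hq'.2)
              unfold dInf
              apply Finset.sup_le
              intro j _
              have := h1 j
              have := h2 j
              omega
            rw [if_pos this]
            linarith
  have hsum : ∀ g : Zd d → ℝ, ∑ a ∈ T, ∑ q ∈ f a, g q = ∑ q ∈ Q, g q := fun g =>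
    Finset.sum_fiberwise_of_maps_to (fun q hq => Finset.mem_image_of_mem _ hq) g
  rw [hgood, Finset.sum_filter]
  have hS : ∑ q ∈ Q, (β + if q ∈ sBdry M Q then (C + D) else 0) ≤
      Q.card * β + (C + D) * (sBdry M Q).card := by
    rw [Finset.sum_add_distrib, Finset.sum_const, nsmul_eq_mul, ← Finset.sum_filter,
      Finset.sum_const, nsmul_eq_mul, mul_comm (C + D)]
    have : ((Q.filter (fun q => q ∈ sBdry M Q)).card : ℝ) ≤ (sBdry M Q).card := by
      exact_mod_cast Finset.card_le_card fun q hq => (Finset.mem_filter.1 hq).2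
    have := mul_le_mul_of_nonneg_right this (by linarith : 0 ≤ C + D)
    linarith
  refine le_trans ?_ hS
  rw [← hsum]
  refine le_trans ?_ (Finset.sum_le_sum hterm)
  rw [Finset.sum_add_distrib]
  have h3 := norm_sum_le T
    (fun a => F (f a) - if shift a (cube d M) ⊆ Q then F (shift a (cube d M)) else 0)
  rw [Finset.sum_sub_distrib] at h3
  have h4 := norm_sub_le_norm_sub_add_norm_sub (F Q) (∑ a ∈ T, F (f a))
    (∑ a ∈ T, if shift a (cube d M) ⊆ Q then F (shift a (cube d M)) else 0)
  linarith

lemma extPat_match {Λ : Zd d → A} {B : Finset (Zd d)} (P : ↥B → A) (a : Zd d) :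
    (∀ y ∈ B, Λ (a + y) = extPat Λ B P y) ↔ (fun y : ↥B => Λ (a + y)) = P := by
  constructor
  · intro h
    ext y
    rw [h y y.2]
    simp [extPat]
  · rintro rfl y hy
    simp [extPat, hy]

open Classical in
lemma occ_eq {Λ : Zd d → A} {M : ℕ} (P : ↥(cube d M) → A) (Q : Finset (Zd d)) :
    occ (cube d M) (extPat Λ (cube d M) P) Q Λ =
      ((good M Q).filter fun a => (fun y : ↥(cube d M) => Λ (a + y)) = P).card := by
  unfold occ good
  rw [Finset.filter_filter]
  congr 1
  ext a
  simp only [Finset.mem_filter, extPat_match]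

open Classical in
lemma sum_occ [NormedAddCommGroup X] [NormedSpace ℝ X] [Fintype A] {Λ : Zd d → A}
    {F : Finset (Zd d) → X} {Ft : Finset (Zd d) → (Zd d → A) → X} (hFt : IsInducedMap Λ F Ft)
    {M : ℕ} (hM : 1 ≤ M) (Q : Finset (Zd d)) :
    ∑ P : ↥(cube d M) → A, (occ (cube d M) (extPat Λ (cube d M) P) Q Λ : ℝ) •
      Ft (cube d M) (extPat Λ (cube d M) P) = ∑ a ∈ good M Q, F (shift a (cube d M)) := by
  rw [← Finset.sum_fiberwise (good M Q) (fun a => (fun y : ↥(cube d M) => Λ (a + y)))]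
  refine Finset.sum_congr rfl fun P _ => ?_
  rw [occ_eq, Nat.cast_smul_eq_nsmul, ← Finset.sum_const]
  refine Finset.sum_congr rfl fun a ha => ?_
  rw [hFt.2 a _ (cube_box hM)]
  apply hFt.1
  intro y hy
  exact ((extPat_match P a).2 (Finset.mem_filter.1 ha).2 y hy).symm


/-- **Theorem (explicit error estimate for the ergodic theorem):** under assumption (E),
for all `j, M` the difference `Δ(j,M)` of the two finite-volume approximants satisfies
`Δ(j,M) ≤ b(C_M)/|C_M| + (C+D)|∂^M Q_j|/|Q_j| + C Σ_{P∈𝓟_M} |♯_P(Λ∩Q_j)/|Q_j| − ν_P|`. -/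
theorem ergodic_error_estimate {X : Type*} [NormedAddCommGroup X] [NormedSpace ℝ X]
    [CompleteSpace X] [Fintype A]
    (hd : 1 ≤ d) (Λ : Zd d → A) (Qs : ℕ → Finset (Zd d)) (hvH : VanHove Qs)
    (ν : Finset (Zd d) → (Zd d → A) → ℝ) (hν : Freqs Λ Qs ν)
    (F : Finset (Zd d) → X) (b : Finset (Zd d) → ℝ) (D : ℝ) (hb : IsBoundaryTerm b D)
    (hInv : Invariant Λ F) (Ft : Finset (Zd d) → (Zd d → A) → X) (hFt : IsInducedMap Λ F Ft)
    (hAA : AlmostAdditive F b) (C : ℝ) (hCpos : 0 < C) (hBd : Bounded F C) :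
    ∀ (j M : ℕ), 1 ≤ M →
      ‖(((Qs j).card : ℝ))⁻¹ • F (Qs j) - patAvg Λ ν Ft M‖ ≤
        b (cube d M) / ((cube d M).card : ℝ)
        + (C + D) * (((sBdry M (Qs j)).card : ℝ) / ((Qs j).card : ℝ))
        + C * ∑ P : ↥(cube d M) → A,
            |(occ (cube d M) (extPat Λ (cube d M) P) (Qs j) Λ : ℝ) / ((Qs j).card : ℝ)
              - ν (cube d M) (extPat Λ (cube d M) P)| := by
  classical
  intro j M hM
  set Q := Qs j with hQ
  set c : ℝ := ((cube d M).card : ℝ) with hc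
  set n : ℝ := (Q.card : ℝ) with hn
  have hn0 : 0 < n := by
    rw [hn]; exact_mod_cast Finset.card_pos.2 (hvH.1 j)
  have hc0 : 0 < c := by
    rw [hc]; exact_mod_cast Finset.card_pos.2 ⟨_, resid_mem hM 0⟩
  set G := ∑ a ∈ good M Q, F (shift a (cube d M)) with hG
  set β := b (cube d M) / c with hβ
  set s : ℝ := ((sBdry M Q).card : ℝ) with hs
  have h1 : ‖c • F Q - G‖ ≤ c * (n * β + (C + D) * s) := by
    have e1 : c • F Q = ∑ x ∈ cube d M, F Q := by
      rw [Finset.sum_const, hc, Nat.cast_smul_eq_nsmul]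
    have e2 : G = ∑ x ∈ cube d M, ∑ a ∈ (good M Q).filter (fun a => resid M a = x),
        F (shift a (cube d M)) :=
      (Finset.sum_fiberwise_of_maps_to (fun a _ => resid_mem hM a) _).symm
    rw [e1, e2, ← Finset.sum_sub_distrib]
    refine (norm_sum_le _ _).trans ?_
    refine (Finset.sum_le_sum fun x hx =>
      tile_estimate hb hAA hCpos hBd Q hM x hx).trans ?_
    rw [Finset.sum_const, nsmul_eq_mul]
  have h2 : ∀ P : ↥(cube d M) → A,
      ‖((occ (cube d M) (extPat Λ (cube d M) P) Q Λ : ℝ) / n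
        - ν (cube d M) (extPat Λ (cube d M) P)) • Ft (cube d M) (extPat Λ (cube d M) P)‖ ≤
      |(occ (cube d M) (extPat Λ (cube d M) P) Q Λ : ℝ) / n
        - ν (cube d M) (extPat Λ (cube d M) P)| * (C * c) := by
    intro P
    by_cases hP : ∃ a, (fun y : ↥(cube d M) => Λ (a + y)) = P
    · obtain ⟨a, ha⟩ := hP
      rw [norm_smul, Real.norm_eq_abs]
      refine mul_le_mul_of_nonneg_left ?_ (abs_nonneg _)
      rw [← hFt.1 (cube d M) _ _ ((extPat_match P a).2 ha), ← hFt.2 a _ (cube_box hM)]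
      refine (hBd _).trans ?_
      rw [card_shift]
    · have h0 : ∀ R : Finset (Zd d), occ (cube d M) (extPat Λ (cube d M) P) R Λ = 0 := by
        intro R
        rw [occ_eq, Finset.card_eq_zero, Finset.filter_eq_empty_iff]
        intro a _ h
        exact hP ⟨a, h⟩
      have hlim := hν _ (cube_box hM) (extPat Λ (cube d M) P)
      simp only [h0, Nat.cast_zero, zero_div] at hlim
      have hz := tendsto_nhds_unique hlim tendsto_const_nhds
      rw [h0, hz]
      simp
  have h3 : n⁻¹ • F Q - patAvg Λ ν Ft M = (n * c)⁻¹ • (c • F Q - G) +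
      c⁻¹ • ∑ P : ↥(cube d M) → A, ((occ (cube d M) (extPat Λ (cube d M) P) Q Λ : ℝ) / n
        - ν (cube d M) (extPat Λ (cube d M) P)) • Ft (cube d M) (extPat Λ (cube d M) P) := by
    have e : ∑ P : ↥(cube d M) → A, ((occ (cube d M) (extPat Λ (cube d M) P) Q Λ : ℝ) / n
        - ν (cube d M) (extPat Λ (cube d M) P)) • Ft (cube d M) (extPat Λ (cube d M) P) =
        n⁻¹ • G - ∑ P : ↥(cube d M) → A,
          ν (cube d M) (extPat Λ (cube d M) P) • Ft (cube d M) (extPat Λ (cube d M) P) := by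
      rw [hG, ← sum_occ hFt hM Q, Finset.smul_sum, ← Finset.sum_sub_distrib]
      refine Finset.sum_congr rfl fun P _ => ?_
      rw [sub_smul, smul_smul, div_eq_inv_mul]
    rw [e, patAvg, smul_sub, smul_sub, smul_smul, smul_smul]
    have k1 : (n * c)⁻¹ * c = n⁻¹ := by field_simp
    have k2 : c⁻¹ * n⁻¹ = (n * c)⁻¹ := by rw [mul_inv, mul_comm]
    rw [k1, k2]
    abel
  rw [h3]
  refine (norm_add_le _ _).trans (add_le_add ?_ ?_)
  · rw [norm_smul, Real.norm_eq_abs, abs_of_pos (by positivity)]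
    refine (mul_le_mul_of_nonneg_left h1 (by positivity)).trans (le_of_eq ?_)
    field_simp
  · rw [norm_smul, Real.norm_eq_abs, abs_of_pos (by positivity)]
    have h5 := (norm_sum_le _ _).trans (Finset.sum_le_sum fun P (_ : P ∈ Finset.univ) => h2 P)
    refine (mul_le_mul_of_nonneg_left h5 (by positivity)).trans (le_of_eq ?_)
    rw [← Finset.sum_mul]
    field_simp

end IDSZd
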